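/- Let S be a Clifford semigroup, write π(x) := x * inv x, set E := E(S), and order E by e ≤ f ⇔ e * f = e. For b, e ∈ E say b ≪ e (b is way below e) if for every nonempty subset D ⊆ E that is directed under ≤ and admits a supremum sup D in (E, ≤) with e ≤ sup D, there exists d ∈ D with b ≤ d; write ↟b := {e ∈ E : b ≪ e}. Suppose given: (i) a function ρ : S → S → ℝ restricting to a metric on E with values in [0,1]; (ii) a sequence b : ℕ → E such that for each j the set ↟b_j is ρ-open in E (whenever b_j ≪ e, the ρ-infimum distance from e to E ∖ ↟b_j is positive) and such that the following separation property holds: for every e ∈ E and all g ≠ h in G_e there exists j with b_j ≪ e and b_j * g ≠ b_j * h; (iii) for each j, a function d_j : S → S → ℝ restricting to a metric on G_{b_j} with values in [0,1], a base point c_j ∈ G_{b_j}, and a sequence (t_{j,k})_{k ≥ 1} in G_{b_j} that is d_j-dense in G_{b_j}. Define a_j(e) := ρ-infimum distance from e to E ∖ ↟b_j (with a_j(e) := 1 when E ∖ ↟b_j is empty); φ̂_j(x) := b_j * x if b_j ≤ π(x) and φ̂_j(x) := c_j otherwise; P_j(x, y) := |a_j(π x) − a_j(π y)| + Σ_{k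 ≥ 1} 2^{−k} |a_j(π x) · d_j(φ̂_j x, t_{j,k}) − a_j(π y) · d_j(φ̂_j y, t_{j,k})|; and d(x, y) := ρ(π x, π y) + Σ_{j ≥ 1} 2^{−j} P_j(x, y). Then d is a well-defined metric on S with 0 ≤ d ≤ 3. -/

import Mathlib

open Classical

/-- `b` is way below `e` in the idempotent semilattice of a Clifford semigroup
(where `e ≤ f ↔ e * f = e`): every nonempty directed set `D` of idempotents
admitting a least upper bound `s` with `e ≤ s` contains some `d` with `b ≤ d`. -/
def WayBelowIdem {S : Type*} [Semigroup S] (b e : S) : Prop :=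
  ∀ D : Set S, D.Nonempty → (∀ x ∈ D, x * x = x) →
    (∀ x ∈ D, ∀ y ∈ D, ∃ z ∈ D, x * z = x ∧ y * z = y) →
    ∀ s : S, s * s = s → (∀ d ∈ D, d * s = d) →
      (∀ u : S, u * u = u → (∀ d ∈ D, d * u = d) → s * u = s) →
      e * s = e → ∃ d ∈ D, b * d = b

/-- `a_b(e)`: the `ρ`-infimum distance from `e` to `E(S) ∖ ↟b`, set to `1`
when `E(S) ∖ ↟b` is empty. -/
noncomputable def wbWeight {S : Type*} [Semigroup S] (ρ : S → S → ℝ)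
    (b e : S) : ℝ :=
  if ({f : S | f * f = f ∧ ¬ WayBelowIdem b f} : Set S).Nonempty then
    sInf (ρ e '' {f : S | f * f = f ∧ ¬ WayBelowIdem b f})
  else 1

/-- The extended bonding map `φ̂ : S → G_b`: `x ↦ b * x` when `b ≤ π x`, and the
base point `c` otherwise. -/
noncomputable def extBond {S : Type*} [Semigroup S] (inv : S → S)
    (b c x : S) : S :=
  if b * (x * inv x) = b then b * x else c

/-- The summand `P_b(x, y)` of the Bowman-type metric, for a single basis
element `b` with base point `c`, local metric `dl` on `G_b` and dense sequence
`t` in `G_b`. -/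
noncomputable def bowmanP {S : Type*} [Semigroup S] (inv : S → S)
    (ρ : S → S → ℝ) (b c : S) (dl : S → S → ℝ) (t : ℕ → S) (x y : S) : ℝ :=
  |wbWeight ρ b (x * inv x) - wbWeight ρ b (y * inv y)| +
    ∑' k : ℕ, (2 : ℝ) ^ (-(k : ℤ) - 1) *
      |wbWeight ρ b (x * inv x) * dl (extBond inv b c x) (t k) -
        wbWeight ρ b (y * inv y) * dl (extBond inv b c y) (t k)|

/-- The explicit Bowman-type distance
`d(x, y) = ρ(π x, π y) + Σ_j 2^{-(j+1)} P_{b_j}(x, y)`. -/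
noncomputable def bowmanDist {S : Type*} [Semigroup S] (inv : S → S)
    (ρ : S → S → ℝ) (b c : ℕ → S) (dl : ℕ → S → S → ℝ) (t : ℕ → ℕ → S)
    (x y : S) : ℝ :=
  ρ (x * inv x) (y * inv y) +
    ∑' j : ℕ, (2 : ℝ) ^ (-(j : ℤ) - 1) * bowmanP inv ρ (b j) (c j) (dl j) (t j) x y

theorem hasSum_two_zpow_neg_sub_one :
    HasSum (fun k : ℕ => (2 : ℝ) ^ (-(k : ℤ) - 1)) 1 := by
  convert hasSum_geometric_two' 1 using 2 with k
  rw [zpow_sub₀ two_ne_zero, zpow_neg, zpow_natCast, zpow_one]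
  field_simp

theorem two_zpow_neg_sub_one_pos (k : ℕ) : (0 : ℝ) < (2 : ℝ) ^ (-(k : ℤ) - 1) := by
  positivity

theorem summable_dyadic_mul {f : ℕ → ℝ} {C : ℝ} (h0 : ∀ k, 0 ≤ f k) (hC : ∀ k, f k ≤ C) :
    Summable (fun k : ℕ => (2 : ℝ) ^ (-(k : ℤ) - 1) * f k) :=
  (hasSum_two_zpow_neg_sub_one.summable.mul_right C).of_nonneg_of_le
    (fun k => mul_nonneg (two_zpow_neg_sub_one_pos k).le (h0 k))
    (fun k => mul_le_mul_of_nonneg_left (hC k) (two_zpow_neg_sub_one_pos k).le)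

theorem tsum_dyadic_mul_nonneg {f : ℕ → ℝ} (h0 : ∀ k, 0 ≤ f k) :
    0 ≤ ∑' k : ℕ, (2 : ℝ) ^ (-(k : ℤ) - 1) * f k :=
  tsum_nonneg fun k => mul_nonneg (two_zpow_neg_sub_one_pos k).le (h0 k)

theorem tsum_dyadic_mul_le {f : ℕ → ℝ} {C : ℝ} (h0 : ∀ k, 0 ≤ f k) (hC : ∀ k, f k ≤ C) :
    ∑' k : ℕ, (2 : ℝ) ^ (-(k : ℤ) - 1) * f k ≤ C := by
  have hs := hasSum_two_zpow_neg_sub_one.mul_right C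
  rw [one_mul] at hs
  exact hasSum_le (fun k => mul_le_mul_of_nonneg_left (hC k) (two_zpow_neg_sub_one_pos k).le)
    (summable_dyadic_mul h0 hC).hasSum hs

theorem eq_zero_of_tsum_dyadic_mul_eq_zero {f : ℕ → ℝ} {C : ℝ} (h0 : ∀ k, 0 ≤ f k)
    (hC : ∀ k, f k ≤ C) (h : ∑' k : ℕ, (2 : ℝ) ^ (-(k : ℤ) - 1) * f k = 0) (k : ℕ) :
    f k = 0 := by
  have hs := (summable_dyadic_mul h0 hC).hasSum
  rw [h, hasSum_zero_iff_of_nonneg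
    (fun k => mul_nonneg (two_zpow_neg_sub_one_pos k).le (h0 k))] at hs
  exact (mul_eq_zero.1 (congrFun hs k)).resolve_left (two_zpow_neg_sub_one_pos k).ne'

theorem tsum_dyadic_mul_le_add {f g h : ℕ → ℝ} {C : ℝ} (hf0 : ∀ k, 0 ≤ f k)
    (hfC : ∀ k, f k ≤ C) (hg0 : ∀ k, 0 ≤ g k) (hgC : ∀ k, g k ≤ C) (hh0 : ∀ k, 0 ≤ h k)
    (hhC : ∀ k, h k ≤ C) (hle : ∀ k, f k ≤ g k + h k) :
    ∑' k : ℕ, (2 : ℝ) ^ (-(k : ℤ) - 1) * f k ≤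
      ∑' k : ℕ, (2 : ℝ) ^ (-(k : ℤ) - 1) * g k + ∑' k : ℕ, (2 : ℝ) ^ (-(k : ℤ) - 1) * h k := by
  rw [← (summable_dyadic_mul hg0 hgC).tsum_add (summable_dyadic_mul hh0 hhC)]
  refine (summable_dyadic_mul hf0 hfC).tsum_le_tsum (fun k => ?_)
    ((summable_dyadic_mul hg0 hgC).add (summable_dyadic_mul hh0 hhC))
  rw [← mul_add]
  exact mul_le_mul_of_nonneg_left (hle k) (two_zpow_neg_sub_one_pos k).le

theorem abs_sub_le_one_of_mem_Icc {u v : ℝ} (hu : u ∈ Set.Icc (0 : ℝ) 1)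
    (hv : v ∈ Set.Icc (0 : ℝ) 1) : |u - v| ≤ 1 :=
  abs_le.2 ⟨by linarith [hu.1, hv.2], by linarith [hu.2, hv.1]⟩

theorem WayBelowIdem.mul_eq {S : Type*} [Semigroup S] {b e : S} (h : WayBelowIdem b e)
    (he : e * e = e) : b * e = b := by
  obtain ⟨d, rfl, hd⟩ := h {e} (Set.singleton_nonempty e) (by simpa using he)
    (by simpa using he) e he (by simpa using he) (fun u _ hu => hu e rfl) he
  exact hd

theorem wbWeight_mem_Icc {S : Type*} [Semigroup S] {ρ : S → S → ℝ}
    (hnonneg : ∀ e f : S, e * e = e → f * f = f → 0 ≤ ρ e f)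
    (hbdd : ∀ e f : S, e * e = e → f * f = f → ρ e f ≤ 1) (b : S) {e : S} (he : e * e = e) :
    wbWeight ρ b e ∈ Set.Icc (0 : ℝ) 1 := by
  unfold wbWeight
  split_ifs with hne
  · have h0 : ∀ r ∈ ρ e '' {f : S | f * f = f ∧ ¬ WayBelowIdem b f}, 0 ≤ r := by
      rintro _ ⟨f, hf, rfl⟩
      exact hnonneg e f he hf.1
    obtain ⟨f, hf⟩ := hne
    exact ⟨Real.sInf_nonneg h0,
      (csInf_le ⟨0, h0⟩ (Set.mem_image_of_mem _ hf)).trans (hbdd e f he hf.1)⟩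
  · simp

section Clifford

variable {S : Type*} [Semigroup S] {inv : S → S}

theorem mul_inv_mul_self (h1 : ∀ x : S, x * inv x * x = x) (x : S) :
    x * inv x * (x * inv x) = x * inv x := by
  rw [← mul_assoc, h1]

theorem mul_mul_inv_mul_of_le (h1 : ∀ x : S, x * inv x * x = x)
    (h4 : ∀ e : S, e * e = e → ∀ y : S, e * y = y * e) {b x : S} (hb : b * b = b)
    (hbx : b * (x * inv x) = b) : b * x * inv (b * x) = b := by
  have hbu : b * (b * x * inv (b * x)) = b * x * inv (b * x) := by
    simp only [← mul_assoc, hb]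
  have hub : b * x * inv (b * x) * b = b := by
    have hcalc : b * x * inv (b * x) * (b * x) * inv x = b := by
      rw [h1, mul_assoc, hbx]
    rwa [mul_assoc, mul_assoc b x (inv x), hbx] at hcalc
  rw [← hbu, h4 b hb, hub]

theorem extBond_mul_inv (h1 : ∀ x : S, x * inv x * x = x)
    (h4 : ∀ e : S, e * e = e → ∀ y : S, e * y = y * e) {b c : S} (hb : b * b = b)
    (hc : c * inv c = b) (x : S) :
    extBond inv b c x * inv (extBond inv b c x) = b := by
  unfold extBond
  split_ifs with h
  · exact mul_mul_inv_mul_of_le h1 h4 hb h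
  · exact hc

end Clifford

section BowmanP

variable {S : Type*} [Semigroup S] {inv : S → S} {ρ : S → S → ℝ} {b c : S}
  {dl : S → S → ℝ} {t : ℕ → S}

theorem bowmanP_nonneg (x y : S) : 0 ≤ bowmanP inv ρ b c dl t x y :=
  add_nonneg (abs_nonneg _) (tsum_dyadic_mul_nonneg fun _ => abs_nonneg _)

theorem bowmanP_le_two (hw : ∀ x : S, wbWeight ρ b (x * inv x) ∈ Set.Icc (0 : ℝ) 1)
    (hF : ∀ (x : S) (k : ℕ),
      wbWeight ρ b (x * inv x) * dl (extBond inv b c x) (t k) ∈ Set.Icc (0 : ℝ) 1) (x y : S) :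
    bowmanP inv ρ b c dl t x y ≤ 2 := by
  have hsum := tsum_dyadic_mul_le (fun k => abs_nonneg _)
    (fun k => abs_sub_le_one_of_mem_Icc (hF x k) (hF y k))
  have habs := abs_sub_le_one_of_mem_Icc (hw x) (hw y)
  unfold bowmanP
  linarith

theorem bowmanP_self (x : S) : bowmanP inv ρ b c dl t x x = 0 := by
  simp [bowmanP]

theorem bowmanP_comm (x y : S) :
    bowmanP inv ρ b c dl t x y = bowmanP inv ρ b c dl t y x := by
  simp only [bowmanP, abs_sub_comm]

theorem bowmanP_triangle
    (hF : ∀ (x : S) (k : ℕ),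
      wbWeight ρ b (x * inv x) * dl (extBond inv b c x) (t k) ∈ Set.Icc (0 : ℝ) 1) (x y z : S) :
    bowmanP inv ρ b c dl t x z ≤ bowmanP inv ρ b c dl t x y + bowmanP inv ρ b c dl t y z := by
  have hsum := tsum_dyadic_mul_le_add
    (fun k => abs_nonneg _) (fun k => abs_sub_le_one_of_mem_Icc (hF x k) (hF z k))
    (fun k => abs_nonneg _) (fun k => abs_sub_le_one_of_mem_Icc (hF x k) (hF y k))
    (fun k => abs_nonneg _) (fun k => abs_sub_le_one_of_mem_Icc (hF y k) (hF z k))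
    (fun k => abs_sub_le _ _ _)
  have habs := abs_sub_le (wbWeight ρ b (x * inv x)) (wbWeight ρ b (y * inv y))
    (wbWeight ρ b (z * inv z))
  unfold bowmanP
  linarith

theorem weight_mul_eq_of_bowmanP_eq_zero
    (hF : ∀ (x : S) (k : ℕ),
      wbWeight ρ b (x * inv x) * dl (extBond inv b c x) (t k) ∈ Set.Icc (0 : ℝ) 1) {x y : S}
    (h : bowmanP inv ρ b c dl t x y = 0) (k : ℕ) :
    wbWeight ρ b (x * inv x) * dl (extBond inv b c x) (t k) =
      wbWeight ρ b (y * inv y) * dl (extBond inv b c y) (t k) := by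
  have hsum := ((add_eq_zero_iff_of_nonneg (abs_nonneg _)
    (tsum_dyadic_mul_nonneg fun _ => abs_nonneg _)).1 h).2
  exact sub_eq_zero.1 (abs_eq_zero.1 (eq_zero_of_tsum_dyadic_mul_eq_zero
    (fun k => abs_nonneg _) (fun k => abs_sub_le_one_of_mem_Icc (hF x k) (hF y k)) hsum k))

end BowmanP

/-- Under the hypotheses (i)–(iii), the explicit Bowman-type
distance is a well-defined metric on `S` with values in `[0, 3]`. -/
theorem bowmanDist_is_metric
    {S : Type*} [Semigroup S] (inv : S → S)
    (h1 : ∀ x : S, x * inv x * x = x)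
    (h2 : ∀ x : S, inv x * x * inv x = inv x)
    (h3 : ∀ x : S, x * inv x = inv x * x)
    (h4 : ∀ e : S, e * e = e → ∀ y : S, e * y = y * e)
    -- (i) `ρ` restricts to a metric on `E(S)` with values in `[0, 1]`
    (ρ : S → S → ℝ)
    (hρnonneg : ∀ e f : S, e * e = e → f * f = f → 0 ≤ ρ e f)
    (hρbdd : ∀ e f : S, e * e = e → f * f = f → ρ e f ≤ 1)
    (hρsymm : ∀ e f : S, e * e = e → f * f = f → ρ e f = ρ f e)
    (hρeq : ∀ e f : S, e * e = e → f * f = f → (ρ e f = 0 ↔ e = f))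
    (hρtri : ∀ e f g : S, e * e = e → f * f = f → g * g = g →
      ρ e g ≤ ρ e f + ρ f g)
    -- (ii) a sequence of idempotents whose way-up sets are `ρ`-open and which
    -- separates the points of each maximal subgroup
    (b : ℕ → S) (hbidem : ∀ j : ℕ, b j * b j = b j)
    (hbopen : ∀ (j : ℕ) (e : S), e * e = e → WayBelowIdem (b j) e →
      0 < wbWeight ρ (b j) e)
    (hbsep : ∀ e : S, e * e = e → ∀ g h : S,
      g * inv g = e → h * inv h = e → g ≠ h →
        ∃ j : ℕ, WayBelowIdem (b j) e ∧ b j * g ≠ b j * h)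
    -- (iii) for each `j`, a metric `dl j` on `G_{b j}` with values in `[0, 1]`,
    -- a base point `c j ∈ G_{b j}`, and a `dl j`-dense sequence `t j` in `G_{b j}`
    (dl : ℕ → S → S → ℝ)
    (hdnonneg : ∀ (j : ℕ) (x y : S), x * inv x = b j → y * inv y = b j →
      0 ≤ dl j x y)
    (hdbdd : ∀ (j : ℕ) (x y : S), x * inv x = b j → y * inv y = b j →
      dl j x y ≤ 1)
    (hdsymm : ∀ (j : ℕ) (x y : S), x * inv x = b j → y * inv y = b j →
      dl j x y = dl j y x)
    (hdeq : ∀ (j : ℕ) (x y : S), x * inv x = b j → y * inv y = b j →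
      (dl j x y = 0 ↔ x = y))
    (hdtri : ∀ (j : ℕ) (x y z : S), x * inv x = b j → y * inv y = b j →
      z * inv z = b j → dl j x z ≤ dl j x y + dl j y z)
    (c : ℕ → S) (hc : ∀ j : ℕ, c j * inv (c j) = b j)
    (t : ℕ → ℕ → S) (ht : ∀ j k : ℕ, t j k * inv (t j k) = b j)
    (htdense : ∀ (j : ℕ) (x : S), x * inv x = b j →
      ∀ ε > (0 : ℝ), ∃ k : ℕ, dl j x (t j k) < ε) :
    -- the series defining `d` are (well-defined, i.e.) summable
    (∀ (j : ℕ) (x y : S), Summable (fun k : ℕ =>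
      (2 : ℝ) ^ (-(k : ℤ) - 1) *
        |wbWeight ρ (b j) (x * inv x) * dl j (extBond inv (b j) (c j) x) (t j k) -
          wbWeight ρ (b j) (y * inv y) * dl j (extBond inv (b j) (c j) y) (t j k)|)) ∧
    (∀ x y : S, Summable (fun j : ℕ =>
      (2 : ℝ) ^ (-(j : ℤ) - 1) * bowmanP inv ρ (b j) (c j) (dl j) (t j) x y)) ∧
    -- `0 ≤ d ≤ 3`
    (∀ x y : S, 0 ≤ bowmanDist inv ρ b c dl t x y ∧
      bowmanDist inv ρ b c dl t x y ≤ 3) ∧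
    -- `d` is a metric on `S`
    (∀ x y : S, bowmanDist inv ρ b c dl t x y = bowmanDist inv ρ b c dl t y x) ∧
    (∀ x y : S, bowmanDist inv ρ b c dl t x y = 0 ↔ x = y) ∧
    (∀ x y z : S, bowmanDist inv ρ b c dl t x z ≤
      bowmanDist inv ρ b c dl t x y + bowmanDist inv ρ b c dl t y z) := by
  have hπ := mul_inv_mul_self h1
  have hφ : ∀ (j : ℕ) (x : S), extBond inv (b j) (c j) x * inv (extBond inv (b j) (c j) x) = b j :=
    fun j => extBond_mul_inv h1 h4 (hbidem j) (hc j)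
  have hw : ∀ (j : ℕ) (x : S), wbWeight ρ (b j) (x * inv x) ∈ Set.Icc (0 : ℝ) 1 :=
    fun j x => wbWeight_mem_Icc hρnonneg hρbdd (b j) (hπ x)
  have hF : ∀ (j : ℕ) (x : S) (k : ℕ), wbWeight ρ (b j) (x * inv x) *
      dl j (extBond inv (b j) (c j) x) (t j k) ∈ Set.Icc (0 : ℝ) 1 := fun j x k =>
    unitInterval.mul_mem (hw j x)
      ⟨hdnonneg j _ _ (hφ j x) (ht j k), hdbdd j _ _ (hφ j x) (ht j k)⟩
  have hP0 : ∀ (x y : S) (j : ℕ), 0 ≤ bowmanP inv ρ (b j) (c j) (dl j) (t j) x y :=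
    fun x y j => bowmanP_nonneg x y
  have hP2 : ∀ (x y : S) (j : ℕ), bowmanP inv ρ (b j) (c j) (dl j) (t j) x y ≤ 2 :=
    fun x y j => bowmanP_le_two (hw j) (hF j) x y
  refine ⟨fun j x y => summable_dyadic_mul (fun k => abs_nonneg _)
      (fun k => abs_sub_le_one_of_mem_Icc (hF j x k) (hF j y k)),
    fun x y => summable_dyadic_mul (hP0 x y) (hP2 x y), fun x y => ⟨?_, ?_⟩, fun x y => ?_,
    fun x y => ⟨fun h => ?_, ?_⟩, fun x y z => ?_⟩
  · exact add_nonneg (hρnonneg _ _ (hπ x) (hπ y)) (tsum_dyadic_mul_nonneg (hP0 x y))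
  · have hρ1 := hρbdd _ _ (hπ x) (hπ y)
    have hsum := tsum_dyadic_mul_le (hP0 x y) (hP2 x y)
    unfold bowmanDist
    linarith
  · simp only [bowmanDist, hρsymm _ _ (hπ x) (hπ y), bowmanP_comm x y]
  · obtain ⟨hρ0, hsum⟩ := (add_eq_zero_iff_of_nonneg (hρnonneg _ _ (hπ x) (hπ y))
      (tsum_dyadic_mul_nonneg (hP0 x y))).1 h
    have hxy : x * inv x = y * inv y := (hρeq _ _ (hπ x) (hπ y)).1 hρ0
    by_contra hne
    obtain ⟨j, hj, hjne⟩ := hbsep _ (hπ y) x y hxy rfl hne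
    have hle := hj.mul_eq (hπ y)
    have hdist : ∀ k, dl j (b j * x) (t j k) = dl j (b j * y) (t j k) := fun k => by
      have hk := weight_mul_eq_of_bowmanP_eq_zero (hF j)
        (eq_zero_of_tsum_dyadic_mul_eq_zero (hP0 x y) (hP2 x y) hsum j) k
      simp only [extBond, hxy, hle, if_true] at hk
      exact mul_left_cancel₀ (hbopen j _ (hπ y) hj).ne' hk
    have hGx : b j * x * inv (b j * x) = b j :=
      mul_mul_inv_mul_of_le h1 h4 (hbidem j) (by rw [hxy, hle])
    have hGy : b j * y * inv (b j * y) = b j := mul_mul_inv_mul_of_le h1 h4 (hbidem j) hle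
    refine hjne ((hdeq j _ _ hGx hGy).1 (le_antisymm (le_of_forall_pos_lt_add fun ε hε => ?_)
      (hdnonneg j _ _ hGx hGy)))
    obtain ⟨k, hk⟩ := htdense j _ hGx (ε / 2) (half_pos hε)
    have htri := hdtri j _ _ _ hGx (ht j k) hGy
    rw [hdsymm j _ _ (ht j k) hGy, ← hdist k] at htri
    linarith
  · rintro rfl
    simp [bowmanDist, bowmanP_self, (hρeq _ _ (hπ x) (hπ x)).2 rfl]
  · have hρ := hρtri _ _ _ (hπ x) (hπ y) (hπ z)
    have hsum := tsum_dyadic_mul_le_add (hP0 x z) (hP2 x z) (hP0 x y) (hP2 x y) (hP0 y z)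
      (hP2 y z) (fun j => bowmanP_triangle (hF j) x y z)
    unfold bowmanDist
    linarith
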